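/- Let 0 ≤ p₁ < 2, 0 ≤ q₂ < 2, p₂ ≥ 0 and q₁ ≥ 0. There exists a constant C > 0, depending only on these exponents, such that for all x₀ ≥ 1 and all x ≥ 2x₀, ∫_{x₀}^{x} ( ∫_{t}^{x} min( ⟨z⟩^{−q₁}·(x−t)^{−p₁} , ⟨z⟩^{−q₂}·(x−t)^{−p₂} ) dz ) dt ≤ C·( ⟨x⟩^{2−p₁−q₁} + ⟨x⟩^{2−p₂−q₂} ). -/

import Mathlib

open MeasureTheory

/-- `⟨x⟩ = √(1+x²)`. -/
noncomputable def jap (x : ℝ) : ℝ := Real.sqrt (1 + x ^ 2)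

lemma jap_ge (x : ℝ) (hx : 0 ≤ x) : x ≤ jap x := by
  unfold jap
  apply Real.le_sqrt_of_sq_le
  linarith

lemma jap_le (x : ℝ) (hx : 1 ≤ x) : jap x ≤ 2 * x := by
  unfold jap
  rw [Real.sqrt_le_left (by linarith)]
  nlinarith

lemma jap_half (x z : ℝ) (hx : 0 ≤ x) (hz : x / 2 ≤ z) : jap x / 2 ≤ jap z := by
  unfold jap
  apply Real.le_sqrt_of_sq_le
  rw [div_pow, Real.sq_sqrt (by positivity)]
  nlinarith

lemma jap_pos (x : ℝ) : 0 < jap x := by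
  unfold jap
  positivity

lemma rpow_neg_anti {a b p : ℝ} (ha : 0 < a) (hab : a ≤ b) (hp : 0 ≤ p) :
    b ^ (-p) ≤ a ^ (-p) :=
  Real.rpow_le_rpow_of_nonpos ha hab (by linarith)

lemma int_pow (a t x : ℝ) (ha : a < 1) (ht : 0 < t) (hx : t ≤ x) :
    (∫ z in t..x, z ^ (-a)) ≤ x ^ (1 - a) / (1 - a) := by
  rw [integral_rpow (Or.inl (by linarith))]
  have e : -a + 1 = 1 - a := by ring
  rw [e]
  have : 0 ≤ t ^ (1 - a) := by positivity
  have h1 : 0 < 1 - a := by linarith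
  gcongr
  linarith

lemma ii_mono (f g : ℝ → ℝ) (a b : ℝ) (hab : a ≤ b) (hg : IntervalIntegrable g volume a b)
    (h0 : ∀ z ∈ Set.Ioo a b, 0 ≤ f z) (h : ∀ z ∈ Set.Ioo a b, f z ≤ g z) :
    (∫ z in a..b, f z) ≤ ∫ z in a..b, g z := by
  rw [intervalIntegral.integral_of_le hab, intervalIntegral.integral_of_le hab,
    integral_Ioc_eq_integral_Ioo, integral_Ioc_eq_integral_Ioo]
  rw [intervalIntegrable_iff_integrableOn_Ioo_of_le hab] at hg
  apply integral_mono_of_nonneg _ hg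
  · exact (ae_restrict_iff' measurableSet_Ioo).2 (Filter.Eventually.of_forall h)
  · exact (ae_restrict_iff' measurableSet_Ioo).2 (Filter.Eventually.of_forall h0)

/-- `⟨x⟩` estimate. -/
theorem stmt10 (p₁ q₂ p₂ q₁ : ℝ) (hp₁0 : 0 ≤ p₁) (hp₁ : p₁ < 2) (hq₂0 : 0 ≤ q₂)
    (hq₂ : q₂ < 2) (hp₂ : 0 ≤ p₂) (hq₁ : 0 ≤ q₁) :
    ∃ C : ℝ, 0 < C ∧ ∀ x₀ x : ℝ, 1 ≤ x₀ → 2 * x₀ ≤ x →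
      (∫ t in x₀..x, ∫ z in t..x,
          min (jap z ^ (-q₁) * (x - t) ^ (-p₁)) (jap z ^ (-q₂) * (x - t) ^ (-p₂))) ≤
        C * (jap x ^ (2 - p₁ - q₁) + jap x ^ (2 - p₂ - q₂)) := by
  obtain ⟨a, rfl⟩ : ∃ a, q₂ = 2 * a := ⟨q₂ / 2, by ring⟩
  have ha0 : 0 ≤ a := by linarith
  have ha1 : 0 < 1 - a := by linarith
  have hp1 : 0 < 2 - p₁ := by linarith
  set C₁ : ℝ := (1 / 2) ^ (-q₁) / (2 - p₁) with hC₁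
  set C₂ : ℝ := (1 / 4) ^ (-p₂) / (1 - a) / (1 - a) with hC₂
  have hC₁p : 0 < C₁ := by positivity
  have hC₂p : 0 < C₂ := by positivity
  refine ⟨C₁ + C₂, by positivity, ?_⟩
  intro x₀ x hx₀ hx
  have hx2 : 2 ≤ x := by linarith
  have hj := jap_pos x
  have hjx := jap_ge x (by linarith)
  have hjx2 := jap_le x (by linarith)
  set J := jap x with hJ
  set A : ℝ := (1 / 2) ^ (-q₁) * J ^ (-q₁) with hA
  set B : ℝ := (1 / 4) ^ (-p₂) * J ^ (-p₂) * (x ^ (1 - a) / (1 - a)) with hB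
  have hA0 : 0 < A := by positivity
  have hB0 : 0 < B := by positivity
  have i1 : IntervalIntegrable (fun t : ℝ => (x - t) ^ (1 - p₁)) volume x₀ x := by
    have := (intervalIntegral.intervalIntegrable_rpow' (a := x - x₀) (b := 0) (r := 1 - p₁)
      (by linarith)).comp_sub_left x
    simpa using this
  have i2 : IntervalIntegrable (fun t : ℝ => t ^ (-a)) volume x₀ x :=
    intervalIntegral.intervalIntegrable_rpow' (by linarith)
  have key : (∫ t in x₀..x, ∫ z in t..x,
          min (jap z ^ (-q₁) * (x - t) ^ (-p₁)) (jap z ^ (-(2 * a)) * (x - t) ^ (-p₂))) ≤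
      ∫ t in x₀..x, (A * (x - t) ^ (1 - p₁) + B * t ^ (-a)) := by
    apply ii_mono _ _ _ _ (by linarith) ((i1.const_mul A).add (i2.const_mul B))
    · rintro t ⟨ht1, ht2⟩
      apply intervalIntegral.integral_nonneg ht2.le
      intro z hz
      have := jap_pos z
      have : 0 < x - t := by linarith
      positivity
    · rintro t ⟨ht1, ht2⟩
      have hxt : 0 < x - t := by linarith
      have ht0 : 0 < t := by linarith
      have hnn : ∀ z ∈ Set.Ioo t x, 0 ≤ min (jap z ^ (-q₁) * (x - t) ^ (-p₁))
          (jap z ^ (-(2 * a)) * (x - t) ^ (-p₂)) := by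
        intro z hz
        have := jap_pos z
        positivity
      rcases le_total (x / 2) t with h | h
      · have h1 := ii_mono _ (fun _ => A * (x - t) ^ (-p₁)) t x ht2.le (by simp) hnn (by
          rintro z ⟨hz1, hz2⟩
          apply (min_le_left _ _).trans
          apply mul_le_mul_of_nonneg_right _ (by positivity)
          rw [hA, ← Real.mul_rpow (by norm_num) hj.le]
          apply rpow_neg_anti (by positivity) _ hq₁
          have := jap_half x z (by linarith) (by linarith)
          linarith)
        have h2 : (∫ z in t..x, A * (x - t) ^ (-p₁)) = A * (x - t) ^ (1 - p₁) := by
          rw [intervalIntegral.integral_const, smul_eq_mul, sub_eq_add_neg 1 p₁,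
            Real.rpow_add hxt, Real.rpow_one]
          ring
        have h3 : 0 ≤ B * t ^ (-a) := by positivity
        linarith
      · set D : ℝ := (1 / 4) ^ (-p₂) * J ^ (-p₂) with hD
        have hD0 : 0 < D := by positivity
        have h1 := ii_mono _ (fun z => D * t ^ (-a) * z ^ (-a)) t x ht2.le
          ((intervalIntegral.intervalIntegrable_rpow' (by linarith)).const_mul _) hnn (by
          rintro z ⟨hz1, hz2⟩
          have hz0 : 0 < z := by linarith
          apply (min_le_right _ _).trans
          have e1 : (x - t) ^ (-p₂) ≤ D := by
            rw [hD, ← Real.mul_rpow (by norm_num) hj.le]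
            apply rpow_neg_anti (by positivity) _ hp₂
            linarith
          have e2 : jap z ^ (-(2 * a)) ≤ t ^ (-a) * z ^ (-a) := by
            have : -(2 * a) = -a + -a := by ring
            rw [this, Real.rpow_add (jap_pos z)]
            have hzj := jap_ge z hz0.le
            have := jap_pos z
            exact mul_le_mul (rpow_neg_anti ht0 (by linarith) ha0)
              (rpow_neg_anti hz0 hzj ha0) (by positivity) (by positivity)
          calc _ ≤ (t ^ (-a) * z ^ (-a)) * D :=
                mul_le_mul e2 e1 (by positivity) (by positivity)
            _ = _ := by ring)
        rw [intervalIntegral.integral_const_mul] at h1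
        have h2 := mul_le_mul_of_nonneg_left (int_pow a t x (by linarith) ht0 ht2.le)
          (by positivity : 0 ≤ D * t ^ (-a))
        have h3 : 0 ≤ A * (x - t) ^ (1 - p₁) := by positivity
        have h4 : B * t ^ (-a) = D * t ^ (-a) * (x ^ (1 - a) / (1 - a)) := by
          rw [hB]; ring
        linarith
  refine key.trans ?_
  rw [intervalIntegral.integral_add (i1.const_mul A) (i2.const_mul B),
    intervalIntegral.integral_const_mul, intervalIntegral.integral_const_mul]
  have b1 : (∫ t in x₀..x, (x - t) ^ (1 - p₁)) ≤ J ^ (2 - p₁) / (2 - p₁) := by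
    rw [intervalIntegral.integral_comp_sub_left (fun s => s ^ (1 - p₁)) x, sub_self,
      integral_rpow (Or.inl (by linarith))]
    have e : 1 - p₁ + 1 = 2 - p₁ := by ring
    rw [e, Real.zero_rpow hp1.ne', sub_zero]
    gcongr
    · linarith
    · linarith
  have b2 := int_pow a x₀ x (by linarith) (by linarith) (by linarith)
  have c1 : A * (∫ t in x₀..x, (x - t) ^ (1 - p₁)) ≤ C₁ * J ^ (2 - p₁ - q₁) := by
    apply (mul_le_mul_of_nonneg_left b1 hA0.le).trans_eq
    rw [sub_eq_add_neg (2 - p₁) q₁, Real.rpow_add hj, hA, hC₁]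
    ring
  have c2 : B * (∫ t in x₀..x, t ^ (-a)) ≤ C₂ * J ^ (2 - p₂ - 2 * a) := by
    apply (mul_le_mul_of_nonneg_left b2 hB0.le).trans
    have hxJ : x ^ (1 - a) ≤ J ^ (1 - a) := Real.rpow_le_rpow (by linarith) hjx ha1.le
    have hx0 : 0 ≤ x ^ (1 - a) := Real.rpow_nonneg (by linarith) _
    have hm := mul_le_mul hxJ hxJ hx0 (hx0.trans hxJ)
    have e : 2 - p₂ - 2 * a = -p₂ + ((1 - a) + (1 - a)) := by ring
    rw [e, Real.rpow_add hj, Real.rpow_add hj (1 - a)]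
    calc _ = C₂ * (J ^ (-p₂) * (x ^ (1 - a) * x ^ (1 - a))) := by
          rw [hB, hC₂]; ring
      _ ≤ _ := by gcongr
  have d1 : 0 < J ^ (2 - p₁ - q₁) := by positivity
  have d2 : 0 < J ^ (2 - p₂ - 2 * a) := by positivity
  nlinarith [mul_pos hC₁p d2, mul_pos hC₂p d1]
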